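/- Kernel of the linearized operator: let Q be the positive radial ground state of -ΔQ + Q = Q³ in ℝ² and 𝓛̃ = -Δ + 1 - 3Q². Then the kernel of 𝓛̃ on H²(ℝ²) is spanned by ∂Q/∂x₁ and ∂Q/∂x₂. -/

import Mathlib

open MeasureTheory Real

noncomputable section

abbrev Pt : Type := EuclideanSpace ℝ (Fin 2)

/-- The Laplacian of a real-valued function on `ℝ²`. -/
def lap (f : Pt → ℝ) (x : Pt) : ℝ :=
  ∑ j : Fin 2, fderiv ℝ (fun y => fderiv ℝ f y (EuclideanSpace.single j 1)) x
    (EuclideanSpace.single j 1)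


lemma mono_aux {f f' : ℝ → ℝ} {s : Set ℝ} (hs : Convex ℝ s)
    (hf : ∀ x ∈ s, HasDerivAt f (f' x) x) (h : ∀ x ∈ interior s, 0 ≤ f' x) : MonotoneOn f s :=
  monotoneOn_of_deriv_nonneg hs (fun x hx => (hf x hx).continuousAt.continuousWithinAt)
    (fun x hx => (hf x (interior_subset hx)).differentiableAt.differentiableWithinAt)
    (fun x hx => by rw [(hf x (interior_subset hx)).deriv]; exact h x hx)

lemma smono_aux {f f' : ℝ → ℝ} {s : Set ℝ} (hs : Convex ℝ s)
    (hf : ∀ x ∈ s, HasDerivAt f (f' x) x) (h : ∀ x ∈ interior s, 0 < f' x) : StrictMonoOn f s :=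
  strictMonoOn_of_deriv_pos hs (fun x hx => (hf x hx).continuousAt.continuousWithinAt)
    (fun x hx => by rw [(hf x (interior_subset hx)).deriv]; exact h x hx)

lemma anti_aux {f f' : ℝ → ℝ} {s : Set ℝ} (hs : Convex ℝ s)
    (hf : ∀ x ∈ s, HasDerivAt f (f' x) x) (h : ∀ x ∈ interior s, f' x ≤ 0) : AntitoneOn f s :=
  antitoneOn_of_deriv_nonpos hs (fun x hx => (hf x hx).continuousAt.continuousWithinAt)
    (fun x hx => (hf x (interior_subset hx)).differentiableAt.differentiableWithinAt)
    (fun x hx => by rw [(hf x (interior_subset hx)).deriv]; exact h x hx)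

lemma no_inf {F : ℝ → ℝ} {R c : ℝ} (hc : 0 < c) (hF : IntegrableOn F (Set.Ioi R))
    (h : ∀ r, R < r → c ≤ F r) : False := by
  have h1 : IntegrableOn (fun _ : ℝ => c) (Set.Ioi R) := by
    refine Integrable.mono hF (by fun_prop) ?_
    refine (ae_restrict_iff' measurableSet_Ioi).2 (Filter.Eventually.of_forall fun r hr => ?_)
    have := h r hr
    rw [Real.norm_of_nonneg hc.le, Real.norm_of_nonneg (hc.le.trans this)]
    exact this
  rw [integrableOn_const_iff] at h1
  simp [hc.ne'] at h1

/-- The radial profile of a ground state. -/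
structure GS (q q1 q2 q3 : ℝ → ℝ) : Prop where
  h1 : ∀ r, HasDerivAt q (q1 r) r
  h2 : ∀ r, HasDerivAt q1 (q2 r) r
  h3 : ∀ r, HasDerivAt q2 (q3 r) r
  ode : ∀ r, r * q2 r + q1 r = r * (q r - q r ^ 3)
  pos : ∀ r, 0 < q r
  small : ∀ ε > 0, ∀ R : ℝ, ∃ s > R, q s < ε

namespace GS
variable {q q1 q2 q3 : ℝ → ℝ}

lemma q1_zero (g : GS q q1 q2 q3) : q1 0 = 0 := by
  have := g.ode 0; simpa using this

lemma ode' (g : GS q q1 q2 q3) (r : ℝ) :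
    2 * q2 r + r * q3 r = (q r - q r ^ 3) + r * (q1 r - 3 * q r ^ 2 * q1 r) := by
  have e1 : HasDerivAt (fun r => r * q2 r + q1 r) (1 * q2 r + r * q3 r + q2 r) r :=
    ((hasDerivAt_id r).mul (g.h3 r)).add (g.h2 r)
  have e2 : HasDerivAt (fun r => r * (q r - q r ^ 3))
      (1 * (q r - q r ^ 3) + r * (q1 r - (3 : ℕ) * q r ^ 2 * q1 r)) r := 
    (hasDerivAt_id r).mul ((g.h1 r).sub ((g.h1 r).pow 3))
  have : (fun r => r * q2 r + q1 r) = (fun r => r * (q r - q r ^ 3)) := funext g.ode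
  rw [this] at e1
  have := e1.unique e2
  push_cast at this
  linarith

lemma hE (g : GS q q1 q2 q3) (r : ℝ) : HasDerivAt (fun r => q1 r ^ 2 / 2 - q r ^ 2 / 2 + q r ^ 4 / 4)
    (q1 r * (q2 r - q r + q r ^ 3)) r := by
  have := ((((g.h2 r).pow 2).div_const 2).sub (((g.h1 r).pow 2).div_const 2)).add (((g.h1 r).pow 4).div_const 4)
  refine this.congr_deriv ?_
  push_cast; ring

lemma hE' (g : GS q q1 q2 q3) {r : ℝ} (hr : 0 < r) : q1 r * (q2 r - q r + q r ^ 3) = - (q1 r ^ 2 / r) := by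
  have := g.ode r
  field_simp
  linear_combination (q1 r) * this

lemma E_anti (g : GS q q1 q2 q3) :
    AntitoneOn (fun r => q1 r ^ 2 / 2 - q r ^ 2 / 2 + q r ^ 4 / 4) (Set.Ici 0) := by
  refine anti_aux (convex_Ici 0) (fun x _ => g.hE x) fun x hx => ?_
  rw [interior_Ici] at hx
  rw [g.hE' hx, neg_nonpos]
  exact div_nonneg (sq_nonneg _) (le_of_lt hx)

lemma E_nonneg (g : GS q q1 q2 q3) {r : ℝ} (hr : 0 ≤ r) :
    0 ≤ q1 r ^ 2 / 2 - q r ^ 2 / 2 + q r ^ 4 / 4 := by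
  by_contra! h
  set e := q1 r ^ 2 / 2 - q r ^ 2 / 2 + q r ^ 4 / 4 with he
  obtain ⟨s, hs, hq⟩ := g.small (√(-e)) (Real.sqrt_pos.2 (by linarith)) r
  have := g.E_anti (a := r) (b := s) hr (hr.trans hs.le) hs.le
  have h2 : q s ^ 2 < -e := by
    rw [← Real.sq_sqrt (show 0 ≤ -e by linarith)]
    have := g.pos s
    gcongr
  simp only [← he] at this
  nlinarith [sq_nonneg (q1 s), sq_nonneg (q s ^ 2)]

lemma E_pos (g : GS q q1 q2 q3) {r : ℝ} (hr : 0 ≤ r) :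
    0 < q1 r ^ 2 / 2 - q r ^ 2 / 2 + q r ^ 4 / 4 := by
  rcases (g.E_nonneg hr).lt_or_eq with h | h
  · exact h
  exfalso
  have h0 : ∀ s, r ≤ s → q1 s ^ 2 / 2 - q s ^ 2 / 2 + q s ^ 4 / 4 = 0 := fun s hs =>
    le_antisymm (by rw [h]; exact g.E_anti (a := r) (b := s) hr (hr.trans hs) hs)
      (g.E_nonneg (hr.trans hs))
  have h1 : ∀ s, r < s → q1 s = 0 := by
    intro s hs
    have e1 := g.hE s
    have e2 : HasDerivAt (fun r => q1 r ^ 2 / 2 - q r ^ 2 / 2 + q r ^ 4 / 4) 0 s := by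
      refine (hasDerivAt_const s (0:ℝ)).congr_of_eventuallyEq ?_
      filter_upwards [Ioi_mem_nhds hs] with x hx using h0 x (le_of_lt hx)
    have e3 := e1.unique e2
    rw [g.hE' (hr.trans_lt hs)] at e3
    have : 0 < s := hr.trans_lt hs
    have e4 : q1 s ^ 2 / s = 0 := by linarith
    rw [div_eq_zero_iff] at e4
    rcases e4 with e4 | e4
    · exact pow_eq_zero_iff (two_ne_zero) |>.1 e4
    · exact absurd e4 this.ne'
  have h2 : MonotoneOn q (Set.Ici r) := mono_aux (convex_Ici r) (fun x _ => g.h1 x) (fun x hx => by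
    rw [interior_Ici] at hx; exact (h1 x hx).ge)
  obtain ⟨s, hs, hq⟩ := g.small (q r) (g.pos r) r
  exact absurd (h2 (a := r) (b := s) Set.self_mem_Ici hs.le hs.le) (not_le.2 hq)

lemma key (g : GS q q1 q2 q3) {r : ℝ} (hr : 0 ≤ r) : q r ^ 2 * (1 - q r ^ 2 / 2) < q1 r ^ 2 := by
  nlinarith [g.E_pos hr]

lemma q2_neg (g : GS q q1 q2 q3) {r : ℝ} (hr : 0 ≤ r) (h : q1 r = 0) : q2 r < 0 := by
  have k := g.key hr
  have p := g.pos r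
  have h2 : 2 < q r ^ 2 := by
    by_contra! hh
    rw [h] at k
    have : 0 ≤ q r ^ 2 * (1 - q r ^ 2 / 2) := mul_nonneg (sq_nonneg _) (by linarith)
    linarith
  have h3 : q r - q r ^ 3 < 0 := by nlinarith
  rcases hr.eq_or_lt with h0 | h0
  · have := g.ode' r
    rw [h, ← h0] at this
    rw [← h0] at h3 ⊢
    linarith
  · have := g.ode r
    rw [h] at this
    have e : q2 r = q r - q r ^ 3 := by
      apply mul_left_cancel₀ h0.ne'; linarith
    linarith

lemma q1_nonpos (g : GS q q1 q2 q3) {r : ℝ} (hr : 0 ≤ r) : q1 r ≤ 0 := by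
  have := image_le_of_deriv_right_lt_deriv_boundary (f := q1) (f' := q2) (a := 0) (b := r)
    (B := fun _ => 0) (B' := fun _ => 0)
    (fun x _ => (g.h2 x).continuousAt.continuousWithinAt)
    (fun x _ => (g.h2 x).hasDerivWithinAt) (by simp [g.q1_zero])
    (fun x => hasDerivAt_const x 0) (fun x hx h => g.q2_neg hx.1 h)
  exact this ⟨hr, le_rfl⟩

lemma q1_neg (g : GS q q1 q2 q3) {r : ℝ} (hr : 0 < r) : q1 r < 0 := by
  refine lt_of_le_of_ne (g.q1_nonpos hr.le) fun h => ?_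
  have hm : IsLocalMax q1 r := by
    filter_upwards [Ioi_mem_nhds hr] with x hx
    rw [h]; exact g.q1_nonpos (le_of_lt hx)
  exact (g.q2_neg hr.le h).ne (hm.hasDerivAt_eq_zero (g.h2 r))

lemma q_anti (g : GS q q1 q2 q3) : StrictAntiOn q (Set.Ici 0) :=
  strictAntiOn_of_deriv_neg (convex_Ici 0) (fun x hx => (g.h1 x).continuousAt.continuousWithinAt)
    (fun x hx => by rw [interior_Ici] at hx; rw [(g.h1 x).deriv]; exact g.q1_neg hx)

lemma q_small (g : GS q q1 q2 q3) {ε : ℝ} (hε : 0 < ε) : ∃ R > 0, ∀ r ≥ R, q r < ε := by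
  obtain ⟨s, hs, hq⟩ := g.small ε hε 0
  exact ⟨s, hs, fun r hr => (g.q_anti.antitoneOn (a := s) (b := r) hs.le (hs.le.trans hr) hr).trans_lt hq⟩

lemma q1_le (g : GS q q1 q2 q3) : ∃ R > 0, ∀ r ≥ R, q r < 1 ∧ q1 r ≤ - (q r / 2) := by
  obtain ⟨R, hR, h⟩ := g.q_small one_pos
  refine ⟨R, hR, fun r hr => ⟨h r hr, ?_⟩⟩
  have h0 : 0 < r := hR.trans_le hr
  have k := g.key h0.le
  have p := g.pos r
  have := h r hr
  have n := g.q1_neg h0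
  by_contra! hh
  have h3 : q1 r ^ 2 ≤ (q r / 2) ^ 2 := by nlinarith
  have h4 : q r ^ 2 < 1 := by nlinarith
  nlinarith [mul_pos p p]

/-- exponential decay -/
lemma decay (g : GS q q1 q2 q3) : ∃ R > 0, ∃ C > 0, ∀ r ≥ R,
    q r ≤ C * exp (-(r / 2)) ∧ - q1 r ≤ C * exp (-(r / 2)) ∧ q r < 1 ∧ q1 r ≤ - (q r / 2) := by
  obtain ⟨R, hR, h⟩ := g.q1_le
  have hd : ∀ x, HasDerivAt (fun r => q r * exp (r / 2)) ((q1 x + q x / 2) * exp (x / 2)) x := by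
    intro x
    have := (g.h1 x).mul (((hasDerivAt_id x).div_const 2).exp)
    refine this.congr_deriv ?_
    simp only [id]; ring
  have ha : AntitoneOn (fun r => q r * exp (r / 2)) (Set.Ici R) := by
    refine anti_aux (convex_Ici R) (fun x _ => hd x) fun x hx => ?_
    rw [interior_Ici] at hx
    have := (h x (le_of_lt hx)).2
    exact mul_nonpos_of_nonpos_of_nonneg (by linarith) (exp_pos _).le
  set K := q R * exp (R / 2) with hK
  have hK0 : 0 < K := mul_pos (g.pos R) (exp_pos _)
  have hq : ∀ r ≥ R, q r ≤ K * exp (-(r / 2)) := by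
    intro r hr
    have := ha (a := R) (b := r) Set.self_mem_Ici hr hr
    rw [exp_neg, ← div_eq_mul_inv, le_div_iff₀ (exp_pos _)]
    exact this
  have hm : MonotoneOn (fun r => r * q1 r) (Set.Ici R) := by
    refine mono_aux (f' := fun r => r * (q r - q r ^ 3)) (convex_Ici R) (fun x _ => ?_) fun x hx => ?_
    · rw [← g.ode x]
      refine ((hasDerivAt_id x).mul (g.h2 x)).congr_deriv ?_
      simp only [id]; ring
    · rw [interior_Ici] at hx
      have h1 := (h x (le_of_lt hx)).1
      have h0 := g.pos x
      have : 0 ≤ q x - q x ^ 3 := by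
        have : q x ^ 3 ≤ q x := pow_le_of_le_one h0.le h1.le (by norm_num)
        linarith
      exact mul_nonneg (hR.trans hx).le this
  refine ⟨R + 1, by linarith, K * exp (1 / 2), by positivity, fun r hr => ⟨?_, ?_, h r (by linarith)⟩⟩
  · refine (hq r (by linarith)).trans ?_
    have : (1:ℝ) ≤ exp (1/2) := one_le_exp (by norm_num)
    gcongr
    nlinarith
  · obtain ⟨ξ, hξ, e⟩ := exists_hasDerivAt_eq_slope q q1 (show r - 1 < r by linarith)
      (fun x _ => (g.h1 x).continuousAt.continuousWithinAt) (fun x _ => g.h1 x)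
    have e' : q1 ξ = q r - q (r - 1) := by rw [e]; ring
    have hξR : R ≤ ξ := by linarith [hξ.1]
    have m := hm (a := ξ) (b := r) hξR (by simp; linarith) hξ.2.le
    simp only at m
    have h1 : q (r - 1) ≤ K * exp (-((r - 1) / 2)) := hq _ (by linarith)
    have h2 : K * exp (1/2) * exp (-(r/2)) = K * exp (-((r - 1) / 2)) := by
      rw [mul_assoc, ← exp_add]; ring_nf
    rw [h2]
    refine le_trans ?_ h1
    have n : q1 ξ < 0 := g.q1_neg (hR.trans_le hξR)
    have p := g.pos r
    have : - q1 r ≤ - q1 ξ := by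
      by_contra! hh
      have hξ0 : 0 < ξ := hR.trans_le hξR
      nlinarith [hξ.2]
    linarith

end GS

lemma first_zero {f : ℝ → ℝ} (hf : Continuous f) {a b : ℝ} (ha : 0 < f a) (hab : a ≤ b)
    (hb : f b ≤ 0) : ∃ c, a < c ∧ c ≤ b ∧ f c = 0 ∧ ∀ x, a ≤ x → x < c → 0 < f x := by
  set S := {x | a ≤ x ∧ f x ≤ 0} with hS
  have hcl : IsClosed S := (isClosed_le continuous_const continuous_id).inter
    (isClosed_le hf continuous_const)
  have hne : S.Nonempty := ⟨b, hab, hb⟩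
  have hbd : BddBelow S := ⟨a, fun x hx => hx.1⟩
  have hm : sInf S ∈ S := hcl.csInf_mem hne hbd
  have hlt : ∀ x, a ≤ x → x < sInf S → 0 < f x := by
    intro x hx hxs
    by_contra! h
    exact absurd (csInf_le hbd (show x ∈ S from ⟨hx, h⟩)) (not_le.2 hxs)
  have hac : a < sInf S := lt_of_le_of_ne hm.1 (fun h => by
    have := hm.2; rw [← h] at this; linarith)
  refine ⟨sInf S, hac, csInf_le hbd ⟨hab, hb⟩, le_antisymm hm.2 ?_, hlt⟩
  refine ge_of_tendsto (x := nhdsWithin (sInf S) (Set.Iio (sInf S))) 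
    (hf.continuousAt.tendsto.mono_left nhdsWithin_le_nhds) ?_
  filter_upwards [Ioo_mem_nhdsLT hac] with x hx using (hlt x hx.1.le hx.2).le

/-- A solution of the ODE for the angular mode `k`. -/
structure Rad (k : ℝ) (q w w1 w2 : ℝ → ℝ) : Prop where
  h1 : ∀ r, HasDerivAt w (w1 r) r
  h2 : ∀ r, HasDerivAt w1 (w2 r) r
  c2 : Continuous w2
  ode : ∀ r, r ^ 2 * w2 r + r * w1 r - k ^ 2 * w r + r ^ 2 * (3 * q r ^ 2 - 1) * w r = 0
  int : IntegrableOn (fun r => r * (w r ^ 2 + w1 r ^ 2)) (Set.Ioi 0)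

namespace Rad
variable {q q1 q2 q3 w w1 w2 : ℝ → ℝ} {k : ℝ}

lemma neg (h : Rad k q w w1 w2) : Rad k q (fun r => - w r) (fun r => - w1 r) (fun r => - w2 r) where
  h1 r := (h.h1 r).neg
  h2 r := (h.h2 r).neg
  c2 := h.c2.neg
  ode r := by linear_combination - h.ode r
  int := by simpa using h.int

lemma cw (h : Rad k q w w1 w2) : Continuous w :=
  continuous_iff_continuousAt.2 fun r => (h.h1 r).continuousAt

lemma cw1 (h : Rad k q w w1 w2) : Continuous w1 :=
  continuous_iff_continuousAt.2 fun r => (h.h2 r).continuousAt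

lemma ode0 (g : GS q q1 q2 q3) (h : Rad 0 q w w1 w2) (r : ℝ) :
    r * w2 r + w1 r = - (r * (3 * q r ^ 2 - 1) * w r) := by
  have cq : Continuous q := continuous_iff_continuousAt.2 fun r => (g.h1 r).continuousAt
  have c2 := h.c2
  have cw := h.cw
  have cw1 := h.cw1
  have : (fun r => r * w2 r + w1 r) = (fun r => - (r * (3 * q r ^ 2 - 1) * w r)) := by
    refine Continuous.ext_on (s := {0}ᶜ) (dense_compl_singleton 0) (by fun_prop) (by fun_prop) ?_
    intro x hx
    have := h.ode x
    apply mul_left_cancel₀ (show x ≠ 0 from hx)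
    simp only
    linear_combination this
  exact congrFun this r

lemma no_W (h : Rad k q w w1 w2) {a b : ℝ → ℝ} {R K c : ℝ} (hR : 1 ≤ R) (hc : 0 < c)
    (hab : ∀ r ≥ R, |a r| ≤ K * r * exp (-(r / 2)) ∧ |b r| ≤ K * r * exp (-(r / 2)))
    (hW : ∀ r ≥ R, c ≤ r * (a r * w1 r - w r * b r)) : False := by
  have hintg : IntegrableOn (fun r => (12 * K ^ 2) * (r * (w r ^ 2 + w1 r ^ 2))) (Set.Ioi R) :=
    (h.int.mono_set (Set.Ioi_subset_Ioi (by linarith))).const_mul _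
  refine no_inf (c := c ^ 2) (by positivity) hintg fun r hr => ?_
  have hr0 : 0 < r := by linarith
  obtain ⟨ha, hb⟩ := hab r hr.le
  have hw := hW r hr.le
  have e1 : c ^ 2 ≤ (r * (a r * w1 r - w r * b r)) ^ 2 := by gcongr
  refine e1.trans ?_
  have e2 : (a r * w1 r - w r * b r) ^ 2 ≤ (a r ^ 2 + b r ^ 2) * (w r ^ 2 + w1 r ^ 2) := by
    nlinarith [sq_nonneg (a r * w r + b r * w1 r)]
  have e3 : ∀ x : ℝ, |x| ≤ K * r * exp (-(r / 2)) → r * x ^ 2 ≤ 6 * K ^ 2 := by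
    intro x hx
    have h1 : x ^ 2 ≤ (K * r * exp (-(r / 2))) ^ 2 := by
      rw [← sq_abs]; gcongr
    have h2 : exp (-(r / 2)) ^ 2 = (exp r)⁻¹ := by
      rw [← exp_nat_mul, ← exp_neg]; congr 1; push_cast; ring
    have h3 : r ^ 3 ≤ 6 * exp r := by
      have := Real.pow_div_factorial_le_exp r hr0.le 3
      norm_num [Nat.factorial] at this
      linarith
    have h4 : r ^ 3 * (exp r)⁻¹ ≤ 6 := by
      rw [← div_eq_mul_inv, div_le_iff₀ (exp_pos _)]; exact h3
    calc r * x ^ 2 ≤ r * (K * r * exp (-(r / 2))) ^ 2 := by gcongr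
      _ = K ^ 2 * (r ^ 3 * (exp r)⁻¹) := by rw [← h2]; ring
      _ ≤ K ^ 2 * 6 := by gcongr
      _ = _ := by ring
  have e4 := e3 _ ha
  have e5 := e3 _ hb
  have e6 : 0 ≤ r * (w r ^ 2 + w1 r ^ 2) := by positivity
  calc (r * (a r * w1 r - w r * b r)) ^ 2 = r ^ 2 * (a r * w1 r - w r * b r) ^ 2 := by ring
    _ ≤ r ^ 2 * ((a r ^ 2 + b r ^ 2) * (w r ^ 2 + w1 r ^ 2)) := by gcongr
    _ = (r * a r ^ 2 + r * b r ^ 2) * (r * (w r ^ 2 + w1 r ^ 2)) := by ring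
    _ ≤ (12 * K ^ 2) * (r * (w r ^ 2 + w1 r ^ 2)) := by
      apply mul_le_mul_of_nonneg_right _ e6
      linarith

lemma zero_of_zero (g : GS q q1 q2 q3) (h : Rad 0 q w w1 w2) (h0 : w 0 = 0) :
    ∀ r, 0 ≤ r → w r = 0 := by
  have h10 : w1 0 = 0 := by simpa using h.ode0 g 0
  set K := 3 * q 0 ^ 2 + 2
  have hd : ∀ x, HasDerivAt (fun r => (w r ^ 2 + w1 r ^ 2) * exp (-(K * r)))
      ((2 * w x * w1 x + 2 * w1 x * w2 x - K * (w x ^ 2 + w1 x ^ 2)) * exp (-(K * x))) x := by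
    intro x
    have := (((h.h1 x).pow 2).add ((h.h2 x).pow 2)).mul ((((hasDerivAt_id x).const_mul K).neg).exp)
    refine this.congr_deriv ?_
    simp only [id, Pi.add_apply, Pi.pow_apply, Pi.neg_apply]; push_cast; ring
  have ha : AntitoneOn (fun r => (w r ^ 2 + w1 r ^ 2) * exp (-(K * r))) (Set.Ici 0) := by
    refine anti_aux (convex_Ici 0) (fun x _ => hd x) fun x hx => ?_
    rw [interior_Ici] at hx
    have hx0 : 0 < x := hx
    have e := h.ode0 g x
    have hq : q x ≤ q 0 := g.q_anti.antitoneOn (a := 0) (b := x) Set.self_mem_Ici hx0.le hx0.le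
    have hq2 : q x ^ 2 ≤ q 0 ^ 2 := by have := g.pos x; gcongr
    refine mul_nonpos_of_nonpos_of_nonneg ?_ (exp_pos _).le
    have e2 : w2 x = - w1 x / x - (3 * q x ^ 2 - 1) * w x := by
      field_simp; linear_combination e
    have e3 : 0 ≤ w1 x ^ 2 / x := by positivity
    have e4 : 2 * w x * w1 x + 2 * w1 x * w2 x - K * (w x ^ 2 + w1 x ^ 2) = 
       - 2 * (w1 x ^ 2 / x) + (2 - 3 * q x ^ 2) * (2 * w x * w1 x) - K * (w x ^ 2 + w1 x ^ 2) := by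
      rw [e2]; ring
    rw [e4]
    have e5 : (2 - 3 * q x ^ 2) * (2 * w x * w1 x) ≤ K * (w x ^ 2 + w1 x ^ 2) := by
      have : |2 - 3 * q x ^ 2| ≤ K := by
        rw [abs_le]; constructor <;> simp only [K] <;> nlinarith [sq_nonneg (q x), sq_nonneg (q 0)]
      have h2 : |2 * w x * w1 x| ≤ w x ^ 2 + w1 x ^ 2 := by
        rw [abs_le]; constructor <;> nlinarith [sq_nonneg (w x + w1 x), sq_nonneg (w x - w1 x)]
      calc _ ≤ |(2 - 3 * q x ^ 2) * (2 * w x * w1 x)| := le_abs_self _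
        _ = |2 - 3 * q x ^ 2| * |2 * w x * w1 x| := abs_mul _ _
        _ ≤ _ := by gcongr
    linarith
  intro r hr
  have := ha (a := 0) (b := r) Set.self_mem_Ici hr hr
  simp only [h0, h10] at this
  have h2 : w r ^ 2 + w1 r ^ 2 ≤ 0 := by
    by_contra! hh
    have := mul_pos hh (exp_pos (-(K * r)))
    norm_num at *
    linarith
  nlinarith [sq_nonneg (w r), sq_nonneg (w1 r)]

lemma not_pos (g : GS q q1 q2 q3) (h : Rad 0 q w w1 w2) (h0 : 0 < w 0) : False := by
  obtain ⟨R, hR, C, hC, hdec⟩ := g.decay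
  -- first Wronskian
  have hA : ∀ x, HasDerivAt (fun r => r * (w r * q1 r - w1 r * q r)) (2 * x * w x * q x ^ 3) x := by
    intro x
    have := (hasDerivAt_id x).mul (((h.h1 x).mul (g.h2 x)).sub ((h.h2 x).mul (g.h1 x)))
    refine this.congr_deriv ?_
    simp only [id, Pi.mul_apply, Pi.sub_apply]
    linear_combination w x * g.ode x - q x * h.ode0 g x
  have hex : ∃ b, 0 ≤ b ∧ w b ≤ 0 := by
    by_contra! hpos
    have hm : StrictMonoOn (fun r => r * (w r * q1 r - w1 r * q r)) (Set.Ici 0) := by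
      refine smono_aux (convex_Ici 0) (fun x _ => hA x) fun x hx => ?_
      rw [interior_Ici] at hx
      have hx0 : 0 < x := hx
      have := hpos x hx0.le
      have := g.pos x
      positivity
    have hc : 0 < 1 * (w 1 * q1 1 - w1 1 * q 1) := by
      have := hm (a := 0) (b := 1) Set.self_mem_Ici (by simp) one_pos
      simpa using this
    refine h.no_W (a := fun r => - q r) (b := fun r => - q1 r) (R := max R 1) (K := C) (le_max_right _ _) hc ?_ ?_
    · intro r hr
      have hr1 : 1 ≤ r := (le_max_right _ _).trans hr
      obtain ⟨d1, d2, -, -⟩ := hdec r ((le_max_left _ _).trans hr)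
      have p := g.pos r
      have n := g.q1_neg (show 0 < r by linarith)
      have : C * exp (-(r / 2)) ≤ C * r * exp (-(r / 2)) := by
        have : C ≤ C * r := by nlinarith
        gcongr
      rw [abs_neg, abs_of_pos p, abs_neg, abs_of_neg n]
      constructor <;> linarith
    · intro r hr
      have hr1 : 1 ≤ r := (le_max_right _ _).trans hr
      have := hm.monotoneOn (a := 1) (b := r) (by simp) (by simp; linarith) hr1
      refine this.trans (le_of_eq (by ring))
  obtain ⟨b, hb, hwb⟩ := hex
  obtain ⟨r0, hr0, -, hz, hpos⟩ := first_zero h.cw h0 hb hwb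
  have hw1 : w1 r0 < 0 := by
    have hm : StrictMonoOn (fun r => r * (w r * q1 r - w1 r * q r)) (Set.Icc 0 r0) := by
      refine smono_aux (convex_Icc 0 r0) (fun x _ => hA x) fun x hx => ?_
      rw [interior_Icc] at hx
      have hx0 : 0 < x := hx.1
      have := hpos x hx0.le hx.2
      have := g.pos x
      positivity
    have := hm (a := 0) (b := r0) ⟨le_rfl, hr0.le⟩ ⟨hr0.le, le_rfl⟩ hr0
    simp only [hz] at this
    have p := g.pos r0
    by_contra! hh
    have : 0 ≤ r0 * (w1 r0 * q r0) := by positivity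
    linarith
  -- the function theta
  have hth : StrictMonoOn (fun r => - (r * q1 r) / q r) (Set.Ici 0) := by
    refine smono_aux (f' := fun x => x / q x ^ 2 * (q1 x ^ 2 - q x ^ 2 + q x ^ 4)) (convex_Ici 0) (fun x _ => ?_) fun x hx => ?_
    · have p := g.pos x
      refine ((((hasDerivAt_id x).mul (g.h2 x)).neg).div (g.h1 x) p.ne').congr_deriv ?_
      simp only [id, Pi.mul_apply, Pi.neg_apply]
      field_simp
      linear_combination (- q x) * g.ode x
    · rw [interior_Ici] at hx
      have hx0 : 0 < x := hx
      have p := g.pos x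
      have k := g.key hx0.le
      have : 0 < q1 x ^ 2 - q x ^ 2 + q x ^ 4 := by nlinarith [pow_pos p 4]
      positivity
  set β := - (r0 * q1 r0) / q r0 with hβ
  have hβ0 : 0 < β := by
    have := g.q1_neg hr0
    have := g.pos r0
    rw [hβ]; apply div_pos _ this; nlinarith
  set v : ℝ → ℝ := fun r => r * q1 r + β * q r with hv
  set v1 : ℝ → ℝ := fun r => r * (q r - q r ^ 3) + β * q1 r with hv1
  have hv0 : v r0 = 0 := by
    have := g.pos r0
    simp only [hv, hβ]; field_simp; ring
  have hvneg : ∀ r, r0 < r → v r < 0 := by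
    intro r hr
    have := hth (a := r0) (b := r) hr0.le (hr0.trans hr).le hr
    simp only [← hβ] at this
    have p := g.pos r
    rw [lt_div_iff₀ p] at this
    simp only [hv]; linarith
  have hW : ∀ x, HasDerivAt (fun r => r * (v r * w1 r - w r * v1 r))
      (- (x * w x * (2 * q x * (1 - q x ^ 2 + β * q x ^ 2)))) x := by
    intro x
    have d1 : HasDerivAt v (v1 x) x := by
      refine (((hasDerivAt_id x).mul (g.h2 x)).add ((g.h1 x).const_mul β)).congr_deriv ?_
      simp only [id, hv1]; linear_combination g.ode x
    have d2 : HasDerivAt v1 ((q x - q x ^ 3) + x * (q1 x - 3 * q x ^ 2 * q1 x) + β * q2 x) x := by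
      refine (((hasDerivAt_id x).mul ((g.h1 x).sub ((g.h1 x).pow 3))).add ((g.h2 x).const_mul β)).congr_deriv ?_
      simp only [id, Pi.sub_apply, Pi.pow_apply]; push_cast; ring
    refine ((hasDerivAt_id x).mul ((d1.mul (h.h2 x)).sub ((h.h1 x).mul d2))).congr_deriv ?_
    simp only [id, Pi.mul_apply, Pi.sub_apply]
    have e1 := g.ode x
    have e2 := h.ode0 g x
    simp only [hv, hv1]
    linear_combination (x * q1 x + β * q x) * e2 - w x * β * e1
  have hL : 0 < 1 - q r0 ^ 2 + β * q r0 ^ 2 := by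
    by_contra! hL
    have hm : StrictMonoOn (fun r => r * (v r * w1 r - w r * v1 r)) (Set.Icc 0 r0) := by
      refine smono_aux (convex_Icc 0 r0) (fun x _ => hW x) fun x hx => ?_
      rw [interior_Icc] at hx
      have hx0 : 0 < x := hx.1
      have p1 := hpos x hx0.le hx.2
      have p2 := g.pos x
      have p3 := g.pos r0
      have lt := g.q_anti (a := x) (b := r0) hx0.le hr0.le hx.2
      have lt2 : q r0 ^ 2 < q x ^ 2 := by gcongr
      have hb1 : β < 1 := by
        by_contra! hh
        nlinarith [sq_nonneg (q r0)]
      have : 0 < - (1 - q x ^ 2 + β * q x ^ 2) := by nlinarith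
      have := mul_pos (mul_pos hx0 p1) (mul_pos (mul_pos two_pos p2) this)
      linarith
    have := hm (a := 0) (b := r0) ⟨le_rfl, hr0.le⟩ ⟨hr0.le, le_rfl⟩ hr0
    simp [hz, hv0] at this
  have hL2 : ∀ r, r0 < r → 0 < 1 - q r ^ 2 + β * q r ^ 2 := by
    intro r hr
    have p2 := g.pos r
    have lt := g.q_anti (a := r0) (b := r) hr0.le (hr0.trans hr).le hr
    have lt2 : q r ^ 2 < q r0 ^ 2 := by gcongr
    rcases le_total 1 β with hb | hb
    · nlinarith [sq_nonneg (q r)]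
    · nlinarith
  have hmW : ∀ s : Set ℝ, Convex ℝ s → s ⊆ Set.Ici r0 → (∀ x ∈ interior s, w x < 0) →
      StrictMonoOn (fun r => r * (v r * w1 r - w r * v1 r)) s := by
    intro s hs hsub hneg
    refine smono_aux hs (fun x _ => hW x) fun x hx => ?_
    have hx1 : r0 < x := by
      have := interior_mono hsub hx
      rwa [interior_Ici] at this
    have p1 := hneg x hx
    have p2 := g.pos x
    have p3 := hL2 x hx1
    have := mul_pos (mul_pos (hr0.trans hx1) (neg_pos.2 p1)) (mul_pos (mul_pos two_pos p2) p3)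
    linarith
  -- just after r0, w is negative
  obtain ⟨δ, hδ, hwδ⟩ : ∃ δ > 0, ∀ x, r0 < x → x ≤ r0 + δ → w x < 0 := by
    have := (h.cw1.continuousAt (x := r0)).eventually (gt_mem_nhds hw1)
    obtain ⟨ε, hε, hball⟩ := Metric.eventually_nhds_iff.1 this
    refine ⟨ε / 2, by linarith, fun x hx hx2 => ?_⟩
    have ha : StrictAntiOn w (Set.Icc r0 (r0 + ε / 2)) := by
      refine strictAntiOn_of_deriv_neg (convex_Icc _ _) h.cw.continuousOn fun y hy => ?_
      rw [interior_Icc] at hy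
      rw [(h.h1 y).deriv]
      apply hball
      rw [Real.dist_eq, abs_lt]; constructor <;> linarith [hy.1, hy.2]
    have := ha (a := r0) (b := x) ⟨le_rfl, by linarith⟩ ⟨hx.le, hx2⟩ hx
    rwa [hz] at this
  have hneg : ∀ r, r0 < r → w r < 0 := by
    by_contra! hh
    obtain ⟨b, hb, hwb⟩ := hh
    have hbδ : r0 + δ ≤ b := by
      by_contra! hh
      linarith [hwδ b hb hh.le]
    obtain ⟨r1, hr1, -, hz1, hneg1⟩ := first_zero (f := fun r => - w r) h.cw.neg
      (a := r0 + δ) (b := b) (by linarith [hwδ (r0 + δ) (by linarith) le_rfl]) hbδ (by linarith)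
    have hz1' : w r1 = 0 := by linarith
    have hr01 : r0 < r1 := by linarith
    have hneg2 : ∀ x, r0 < x → x < r1 → w x < 0 := by
      intro x hx hx1
      rcases le_total x (r0 + δ) with h3 | h3
      · exact hwδ x hx h3
      · linarith [hneg1 x h3 hx1]
    have hm := hmW (Set.Icc r0 r1) (convex_Icc _ _) (fun x hx => hx.1) (fun x hx => by
      rw [interior_Icc] at hx; exact hneg2 x hx.1 hx.2)
    have := hm (a := r0) (b := r1) ⟨le_rfl, hr01.le⟩ ⟨hr01.le, le_rfl⟩ hr01
    simp only [hz, hz1', hv0] at this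
    have hv2 := hvneg r1 hr01
    have hw1' : w1 r1 < 0 := by
      by_contra! hh
      have : 0 ≤ r1 * (-(v r1) * w1 r1) := by
        have : 0 ≤ - v r1 := by linarith
        have : 0 < r1 := by linarith
        positivity
      linarith
    -- then w is decreasing near r1, positive before
    have hev := (h.cw1.continuousAt (x := r1)).eventually (gt_mem_nhds hw1')
    obtain ⟨ε, hε, hball⟩ := Metric.eventually_nhds_iff.1 hev
    have hlt : max r0 (r1 - ε) < r1 := max_lt hr01 (by linarith)
    obtain ⟨y, hy1, hy2⟩ := exists_between hlt
    have hy3 : r0 < y := (le_max_left _ _).trans_lt hy1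
    have hy4 : r1 - ε < y := (le_max_right _ _).trans_lt hy1
    have ha : StrictAntiOn w (Set.Icc y r1) := by
      refine strictAntiOn_of_deriv_neg (convex_Icc _ _) h.cw.continuousOn fun z hzz => ?_
      rw [interior_Icc] at hzz
      rw [(h.h1 z).deriv]
      apply hball
      rw [Real.dist_eq, abs_lt]; constructor <;> linarith [hzz.1, hzz.2]
    have := ha (a := y) (b := r1) ⟨le_rfl, hy2.le⟩ ⟨hy2.le, le_rfl⟩ hy2
    have := hneg2 y hy3 hy2
    linarith
  have hm := hmW (Set.Ici r0) (convex_Ici _) (fun x hx => hx) (fun x hx => by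
      rw [interior_Ici] at hx; exact hneg x hx)
  have hc := hm (a := r0) (b := r0 + 1) Set.self_mem_Ici (by simp) (by linarith)
  simp only [hz, hv0] at hc
  refine h.no_W (a := v) (b := v1) (R := max R (max 1 (r0 + 1))) (K := C * (1 + β))
    (c := (r0 + 1) * (v (r0 + 1) * w1 (r0 + 1) - w (r0 + 1) * v1 (r0 + 1)))
    ((le_max_left _ _).trans (le_max_right _ _)) (by linarith) ?_ ?_
  · intro r hr
    have hr1 : 1 ≤ r := (le_max_left _ _).trans ((le_max_right _ _).trans hr)
    obtain ⟨d1, d2, d3, -⟩ := hdec r ((le_max_left _ _).trans hr)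
    have p := g.pos r
    have n := g.q1_neg (show 0 < r by linarith)
    set X := C * exp (-(r / 2)) with hX
    have hX0 : 0 < X := by positivity
    have e : C * (1 + β) * r * exp (-(r / 2)) = r * X + β * (r * X) := by rw [hX]; ring
    rw [e]
    have hXr : X ≤ r * X := by nlinarith
    have hq3 : q r ^ 3 ≤ q r := pow_le_of_le_one p.le d3.le (by norm_num)
    have hq3' : 0 < q r ^ 3 := by positivity
    have f1 : r * (-q1 r) ≤ r * X := by gcongr
    have f2 : 0 ≤ r * (- q1 r) := by apply mul_nonneg <;> linarith
    have f3 : β * q r ≤ β * (r * X) := by gcongr; linarith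
    have f4 : 0 ≤ β * q r := by positivity
    have f5 : r * (q r - q r ^ 3) ≤ r * X := by gcongr; linarith
    have f6 : 0 ≤ r * (q r - q r ^ 3) := by apply mul_nonneg <;> linarith
    have f7 : β * (- q1 r) ≤ β * (r * X) := by gcongr; linarith
    have f8 : 0 ≤ β * (- q1 r) := by apply mul_nonneg <;> linarith
    have f9 : 0 ≤ β * (r * X) := by positivity
    have f10 : 0 ≤ r * X := by positivity
    simp only [hv, hv1]
    constructor <;> rw [abs_le] <;> constructor <;> linarith
  · intro r hr
    have hr1 : r0 + 1 ≤ r := (le_max_right _ _).trans ((le_max_right _ _).trans hr)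
    exact hm.monotoneOn (a := r0 + 1) (b := r) (by simp) (by simp; linarith) hr1

theorem radial_zero (g : GS q q1 q2 q3) (h : Rad 0 q w w1 w2) : ∀ r, 0 ≤ r → w r = 0 := by
  rcases lt_trichotomy (w 0) 0 with h0 | h0 | h0
  · exact (h.neg.not_pos g (by linarith)).elim
  · exact h.zero_of_zero g h0
  · exact (h.not_pos g h0).elim

end Rad

namespace Rad
variable {q q1 q2 q3 w w1 w2 : ℝ → ℝ} {k : ℝ}

lemma w_zero (h : Rad k q w w1 w2) (hk : 1 ≤ k) : w 0 = 0 := by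
  have := h.ode 0
  have hk0 : k ^ 2 ≠ 0 := by positivity
  simpa [hk0, (show k ≠ 0 by positivity)] using this

lemma hG (g : GS q q1 q2 q3) (h : Rad k q w w1 w2) {x : ℝ} (hx : 0 < x) :
    HasDerivAt (fun r => r * (w r * w1 r - w r ^ 2 * (q2 r / q1 r)))
      (x * (w1 x - w x * (q2 x / q1 x)) ^ 2 + (k ^ 2 - 1) * w x ^ 2 / x) x := by
  have hq := (g.q1_neg hx).ne
  refine ((hasDerivAt_id x).mul (((h.h1 x).mul (h.h2 x)).sub
    (((h.h1 x).pow 2).mul ((g.h3 x).div (g.h2 x) hq)))).congr_deriv ?_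
  simp only [id, Pi.mul_apply, Pi.sub_apply, Pi.pow_apply, Pi.div_apply]
  have e1 := g.ode x
  have e2 := g.ode' x
  have e3 := h.ode x
  have e4 : q3 x = (-2 * q2 x + (q x - q x ^ 3) + x * (q1 x - 3 * q x ^ 2 * q1 x)) / x := by
    field_simp; linear_combination e2
  have e5 : w2 x = (- x * w1 x + k ^ 2 * w x - x ^ 2 * (3 * q x ^ 2 - 1) * w x) / x ^ 2 := by
    field_simp; linear_combination e3
  have e6 : q2 x = (x * (q x - q x ^ 3) - q1 x) / x := by
    field_simp; linear_combination e1
  rw [e4, e5, e6]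
  push_cast
  field_simp
  ring

lemma G_tendsto (g : GS q q1 q2 q3) (h : Rad k q w w1 w2) (hk : 1 ≤ k) :
    Filter.Tendsto (fun r => r * (w r * w1 r - w r ^ 2 * (q2 r / q1 r)))
      (nhdsWithin 0 (Set.Ioi 0)) (nhds 0) := by
  have hw := h.w_zero hk
  have hq20 : q2 0 ≠ 0 := (g.q2_neg le_rfl g.q1_zero).ne
  have t1 : Filter.Tendsto (fun r => r⁻¹ * q1 r) (nhdsWithin 0 (Set.Ioi 0)) (nhds (q2 0)) := by
    have := (hasDerivAt_iff_tendsto_slope_zero.1 (g.h2 0))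
    simp only [zero_add, g.q1_zero, sub_zero, smul_eq_mul] at this
    exact this.mono_left (nhdsWithin_mono _ (fun x hx => (ne_of_gt hx)))
  have t2 : Filter.Tendsto q2 (nhdsWithin 0 (Set.Ioi 0)) (nhds (q2 0)) :=
    (g.h3 0).continuousAt.tendsto.mono_left nhdsWithin_le_nhds
  have t3 : Filter.Tendsto w (nhdsWithin 0 (Set.Ioi 0)) (nhds 0) := by
    have := (h.cw.tendsto 0).mono_left (nhdsWithin_le_nhds (s := Set.Ioi 0))
    rwa [hw] at this
  have t4 : Filter.Tendsto w1 (nhdsWithin 0 (Set.Ioi 0)) (nhds (w1 0)) :=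
    (h.cw1.tendsto 0).mono_left nhdsWithin_le_nhds
  have t5 : Filter.Tendsto (fun r : ℝ => r) (nhdsWithin 0 (Set.Ioi 0)) (nhds 0) :=
    nhdsWithin_le_nhds
  have := (t5.mul (t3.mul t4)).sub ((t3.pow 2).mul (t2.div t1 hq20))
  simp only [zero_mul, mul_zero, ne_eq, OfNat.ofNat_ne_zero, not_false_eq_true, zero_pow, sub_zero] at this
  refine this.congr' ?_
  filter_upwards [self_mem_nhdsWithin] with x hx
  have hx0 : 0 < x := hx
  have hq := (g.q1_neg hx0).ne
  simp only [Pi.div_apply]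
  field_simp

lemma G_zero (g : GS q q1 q2 q3) (h : Rad k q w w1 w2) (hk : 1 ≤ k) {x : ℝ} (hx : 0 < x) :
    x * (w x * w1 x - w x ^ 2 * (q2 x / q1 x)) = 0 := by
  set G : ℝ → ℝ := fun r => r * (w r * w1 r - w r ^ 2 * (q2 r / q1 r)) with hGdef
  have hm : MonotoneOn G (Set.Ioi 0) := by
    refine mono_aux (convex_Ioi 0) (fun x hx => h.hG g hx) fun x hx => ?_
    rw [interior_Ioi] at hx
    have hx0 : 0 < x := hx
    have : 0 ≤ k ^ 2 - 1 := by nlinarith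
    positivity
  have hnn : ∀ x, 0 < x → 0 ≤ G x := by
    intro x hx
    refine le_of_tendsto (h.G_tendsto g hk) ?_
    filter_upwards [Ioo_mem_nhdsGT hx] with y hy
    exact hm (a := y) (b := x) hy.1 hx hy.2.le
  by_contra hne
  have hpos : 0 < G x := lt_of_le_of_ne (hnn x hx) (Ne.symm hne)
  obtain ⟨R, hR, C, hC, hdec⟩ := g.decay
  have hintg : IntegrableOn (fun r => 4 * (r * (w r ^ 2 + w1 r ^ 2))) (Set.Ioi (max x (max R 1))) :=
    (h.int.mono_set (Set.Ioi_subset_Ioi (by simp [hx.le]))).const_mul _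
  refine no_inf (c := G x) hpos hintg fun r hr => ?_
  have hr1 : x < r := (le_max_left _ _).trans_lt hr
  have hr2 : R < r := ((le_max_left _ _).trans (le_max_right _ _)).trans_lt hr
  have hr3 : 1 < r := ((le_max_right _ _).trans (le_max_right _ _)).trans_lt hr
  have hr0 : 0 < r := by linarith
  refine (hm (a := x) (b := r) hx hr0 hr1.le).trans ?_
  obtain ⟨-, -, d3, d4⟩ := hdec r hr2.le
  have n := g.q1_neg hr0
  have p := g.pos r
  have e1 := g.ode r
  have hb : - (q2 r / q1 r) ≤ 3 := by
    have e6 : q2 r = (q r - q r ^ 3) - q1 r / r := by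
      field_simp; linear_combination e1
    have e7 : - (q2 r / q1 r) = (q r - q r ^ 3) / (- q1 r) + 1 / r := by
      have hn := n.ne
      rw [e6]; field_simp; ring
    have e8 : 1 / r ≤ 1 := by rw [div_le_one hr0]; linarith
    have e9 : (q r - q r ^ 3) / (- q1 r) ≤ 2 := by
      rw [div_le_iff₀ (by linarith)]
      have : 0 < q r ^ 3 := by positivity
      linarith
    linarith
  have h1 : w r * w1 r - w r ^ 2 * (q2 r / q1 r) ≤ 4 * (w r ^ 2 + w1 r ^ 2) := by
    have : w r ^ 2 * (- (q2 r / q1 r)) ≤ w r ^ 2 * 3 := by gcongr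
    nlinarith [sq_nonneg (w r - w1 r), sq_nonneg (w r), sq_nonneg (w1 r)]
  calc G r = r * (w r * w1 r - w r ^ 2 * (q2 r / q1 r)) := rfl
    _ ≤ r * (4 * (w r ^ 2 + w1 r ^ 2)) := by gcongr
    _ = _ := by ring

lemma dG_zero (g : GS q q1 q2 q3) (h : Rad k q w w1 w2) (hk : 1 ≤ k) {x : ℝ} (hx : 0 < x) :
    x * (w1 x - w x * (q2 x / q1 x)) ^ 2 + (k ^ 2 - 1) * w x ^ 2 / x = 0 := by
  refine (h.hG g hx).unique ?_
  refine (hasDerivAt_const x (0:ℝ)).congr_of_eventuallyEq ?_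
  filter_upwards [Ioi_mem_nhds hx] with y hy using h.G_zero g hk hy

theorem high_zero (g : GS q q1 q2 q3) (h : Rad k q w w1 w2) (hk : 1 < k) :
    ∀ r, 0 ≤ r → w r = 0 := by
  intro x hx
  rcases hx.eq_or_lt with hx | hx
  · rw [← hx]; exact h.w_zero hk.le
  have e := h.dG_zero g hk.le hx
  have e1 : 0 ≤ x * (w1 x - w x * (q2 x / q1 x)) ^ 2 := by positivity
  have hk2 : 0 < k ^ 2 - 1 := by nlinarith
  have e2 : (k ^ 2 - 1) * w x ^ 2 / x ≤ 0 := by linarith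
  by_contra hne
  have : 0 < (k ^ 2 - 1) * w x ^ 2 / x := by positivity
  linarith

theorem one_mult (g : GS q q1 q2 q3) (h : Rad 1 q w w1 w2) :
    ∃ c, ∀ r, 0 ≤ r → w r = c * q1 r := by
  have hd : ∀ x, 0 < x → HasDerivAt (fun r => w r / q1 r) 0 x := by
    intro x hx
    have hq := (g.q1_neg hx).ne
    refine ((h.h1 x).div (g.h2 x) hq).congr_deriv ?_
    have e := h.dG_zero g le_rfl hx
    have e2 : (w1 x - w x * (q2 x / q1 x)) ^ 2 = 0 := by
      have : x * (w1 x - w x * (q2 x / q1 x)) ^ 2 = 0 := by simpa using e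
      rcases mul_eq_zero.1 this with h | h
      · exact absurd h hx.ne'
      · exact h
    have e3 := pow_eq_zero_iff (two_ne_zero) |>.1 e2
    have e4 : w1 x * q1 x - w x * q2 x = 0 := by
      field_simp at e3; linear_combination e3
    rw [e4, zero_div]
  refine ⟨w 1 / q1 1, fun r hr => ?_⟩
  rcases hr.eq_or_lt with h0 | h0
  · rw [← h0, h.w_zero le_rfl, g.q1_zero, mul_zero]
  have m1 : MonotoneOn (fun r => w r / q1 r) (Set.Ioi 0) :=
    mono_aux (convex_Ioi 0) (fun x hx => hd x hx) (fun _ _ => le_rfl)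
  have m2 : AntitoneOn (fun r => w r / q1 r) (Set.Ioi 0) :=
    anti_aux (convex_Ioi 0) (fun x hx => hd x hx) (fun _ _ => le_rfl)
  have : w r / q1 r = w 1 / q1 1 := by
    rcases le_total r 1 with h1 | h1
    · exact le_antisymm (m1 (a := r) (b := 1) h0 (Set.mem_Ioi.2 one_pos) h1) (m2 (a := r) (b := 1) h0 (Set.mem_Ioi.2 one_pos) h1)
    · exact le_antisymm (m2 (a := 1) (b := r) (Set.mem_Ioi.2 one_pos) h0 h1) (m1 (a := 1) (b := r) (Set.mem_Ioi.2 one_pos) h0 h1)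
  rw [← this, div_mul_cancel₀ _ (g.q1_neg h0).ne]

end Rad

/-- partial derivative -/
def pd (j : Fin 2) (f : Pt → ℝ) : Pt → ℝ := fun x => fderiv ℝ f x (EuclideanSpace.single j 1)

lemma lap_eq (f : Pt → ℝ) (x : Pt) : lap f x = pd 0 (pd 0 f) x + pd 1 (pd 1 f) x := by
  simp only [lap, Fin.sum_univ_two]; rfl

lemma pd_contDiff {n m : WithTop ℕ∞} {f : Pt → ℝ} (hf : ContDiff ℝ m f) (h : n + 1 ≤ m) (j : Fin 2) :
    ContDiff ℝ n (pd j f) :=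
  (hf.fderiv_right h).clm_apply contDiff_const

lemma pd_comm {f : Pt → ℝ} (hf : ContDiff ℝ 2 f) (i j : Fin 2) (x : Pt) :
    pd i (pd j f) x = pd j (pd i f) x := by
  have hd : DifferentiableAt ℝ (fderiv ℝ f) x :=
    ((hf.fderiv_right (m := 1) (by norm_num)).differentiable (by norm_num)) x
  have key : ∀ i j, pd i (pd j f) x =
      fderiv ℝ (fderiv ℝ f) x (EuclideanSpace.single i 1) (EuclideanSpace.single j 1) := by
    intro i j
    change fderiv ℝ (fun y => fderiv ℝ f y (EuclideanSpace.single j 1)) x _ = _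
    rw [fderiv_clm_apply hd (differentiableAt_const _)]
    simp
  rw [key, key]
  exact (hf.contDiffAt.isSymmSndFDerivAt (by simp)).eq _ _

/-- polar coordinates -/
def P (r φ : ℝ) : Pt :=
  (r * cos φ) • EuclideanSpace.single (0 : Fin 2) (1:ℝ) + (r * sin φ) • EuclideanSpace.single (1 : Fin 2) (1:ℝ)

lemma P_cont : Continuous (fun p : ℝ × ℝ => P p.1 p.2) := by
  unfold P; fun_prop

lemma P_eq (r φ : ℝ) : P r φ = !₂[r * cos φ, r * sin φ] := by
  ext i; fin_cases i <;> simp [P]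

lemma norm_P (r φ : ℝ) : ‖P r φ‖ = |r| := by
  rw [P_eq, EuclideanSpace.norm_eq]
  simp only [Fin.sum_univ_two, Real.norm_eq_abs, sq_abs]
  rw [← Real.sqrt_sq_eq_abs]
  congr 1
  simp
  linear_combination r ^ 2 * sin_sq_add_cos_sq φ

lemma exists_P (x : Pt) : ∃ r φ : ℝ, 0 ≤ r ∧ x = P r φ := by
  let z : ℂ := ⟨x 0, x 1⟩
  refine ⟨‖z‖, Complex.arg z, norm_nonneg _, ?_⟩
  have h1 : ‖z‖ * cos (Complex.arg z) = x 0 := Complex.norm_mul_cos_arg z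
  have h2 : ‖z‖ * sin (Complex.arg z) = x 1 := Complex.norm_mul_sin_arg z
  rw [P_eq, h1, h2]
  ext i; fin_cases i <;> simp

lemma deriv_r {f : Pt → ℝ} (hf : Differentiable ℝ f) (r φ : ℝ) :
    HasDerivAt (fun r => f (P r φ)) (cos φ * pd 0 f (P r φ) + sin φ * pd 1 f (P r φ)) r := by
  have hP : HasDerivAt (fun r => P r φ) ((1 * cos φ) • EuclideanSpace.single (0 : Fin 2) (1:ℝ)
      + (1 * sin φ) • EuclideanSpace.single (1 : Fin 2) (1:ℝ)) r :=
    (((hasDerivAt_id r).mul_const (cos φ)).smul_const _).add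
      (((hasDerivAt_id r).mul_const (sin φ)).smul_const _)
  have := (hf (P r φ)).hasFDerivAt.comp_hasDerivAt r hP
  refine this.congr_deriv ?_
  simp [pd, map_add, map_smul]

lemma deriv_phi {f : Pt → ℝ} (hf : Differentiable ℝ f) (r φ : ℝ) :
    HasDerivAt (fun φ => f (P r φ)) (r * (- sin φ * pd 0 f (P r φ) + cos φ * pd 1 f (P r φ))) φ := by
  have hP : HasDerivAt (fun φ => P r φ) ((r * (- sin φ)) • EuclideanSpace.single (0 : Fin 2) (1:ℝ)
      + (r * cos φ) • EuclideanSpace.single (1 : Fin 2) (1:ℝ)) φ :=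
    (((hasDerivAt_cos φ).const_mul r).smul_const _).add
      (((hasDerivAt_sin φ).const_mul r).smul_const _)
  have := (hf (P r φ)).hasFDerivAt.comp_hasDerivAt φ hP
  refine this.congr_deriv ?_
  simp only [pd, map_add, map_smul, smul_eq_mul]
  ring

lemma hasDerivAt_param {F F' : ℝ → ℝ → ℝ} (hF : ∀ r, Continuous (F r))
    (hF' : Continuous (Function.uncurry F'))
    (hd : ∀ r φ, HasDerivAt (fun r => F r φ) (F' r φ) r) (a b r0 : ℝ) :
    HasDerivAt (fun r => ∫ φ in a..b, F r φ) (∫ φ in a..b, F' r0 φ) r0 := by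
  have hcomp : IsCompact (Metric.closedBall r0 1 ×ˢ Set.uIcc a b) :=
    (isCompact_closedBall r0 1).prod isCompact_uIcc
  obtain ⟨C, hC⟩ := hcomp.exists_bound_of_continuousOn hF'.continuousOn
  have hF'1 : ∀ r, Continuous (F' r) := fun r => hF'.comp (by fun_prop : Continuous fun φ => (r, φ))
  refine (intervalIntegral.hasDerivAt_integral_of_dominated_loc_of_deriv_le
    (bound := fun _ => C) (s := Metric.closedBall r0 1) (Metric.closedBall_mem_nhds r0 one_pos)
    (Filter.Eventually.of_forall fun r => (hF r).aestronglyMeasurable)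
    ((hF r0).intervalIntegrable _ _) (hF'1 r0).aestronglyMeasurable ?_ (by simp) ?_).2
  · refine Filter.Eventually.of_forall fun t ht x hx => ?_
    exact hC (x, t) ⟨hx, Set.uIoc_subset_uIcc ht⟩
  · exact Filter.Eventually.of_forall fun t _ x _ => hd x t

lemma polar_integrable {g : Pt → ℝ} (hg : Integrable g) :
    IntegrableOn (fun p : ℝ × ℝ => p.1 * g (P p.1 p.2)) (Set.Ioi (0:ℝ) ×ˢ Set.Ioo (-π) π) := by
  have e1 : Integrable (fun y : Fin 2 → ℝ => g (WithLp.toLp 2 y)) :=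
    ((PiLp.volume_preserving_toLp (Fin 2)).integrable_comp_emb
      (MeasurableEquiv.toLp 2 (Fin 2 → ℝ)).measurableEmbedding).2 hg
  have e2 : Integrable (fun p : ℝ × ℝ => g (WithLp.toLp 2 (MeasurableEquiv.finTwoArrow.symm p))) :=
    (((volume_preserving_finTwoArrow ℝ).symm _).integrable_comp_emb
      (MeasurableEquiv.finTwoArrow.symm).measurableEmbedding).2 e1
  have e3 := (integrableOn_image_iff_integrableOn_abs_det_fderiv_smul volume
    (s := polarCoord.target) polarCoord.open_target.measurableSet
    (fun p _ => (hasFDerivAt_polarCoord_symm p).hasFDerivWithinAt) polarCoord.symm.injOn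
    (fun p : ℝ × ℝ => g (WithLp.toLp 2 (MeasurableEquiv.finTwoArrow.symm p)))).1 e2.integrableOn
  refine e3.congr_fun ?_ polarCoord.open_target.measurableSet
  intro p hp
  have hp1 : 0 < p.1 := hp.1
  simp only [det_fderivPolarCoordSymm, abs_of_pos hp1, smul_eq_mul, polarCoord_symm_apply]
  rw [P_eq]
  rfl

lemma cs_aux {f : ℝ → ℝ} (hf : Continuous f) :
    (∫ φ in (-π)..π, f φ) ^ 2 ≤ (2 * π) * ∫ φ in (-π)..π, f φ ^ 2 := by
  set I := ∫ φ in (-π)..π, f φ with hI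
  set m := I / (2 * π)
  have hpi := pi_pos
  have h1 : 0 ≤ ∫ φ in (-π)..π, (f φ - m) ^ 2 :=
    intervalIntegral.integral_nonneg (by linarith) (fun _ _ => sq_nonneg _)
  have h2 : ∫ φ in (-π)..π, (f φ - m) ^ 2 = (∫ φ in (-π)..π, f φ ^ 2) - 2 * m * I + m ^ 2 * (2 * π) := by
    have : ∀ φ, (f φ - m) ^ 2 = f φ ^ 2 - 2 * m * f φ + m ^ 2 := fun φ => by ring
    simp_rw [this]
    rw [intervalIntegral.integral_add, intervalIntegral.integral_sub, intervalIntegral.integral_const_mul,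
      intervalIntegral.integral_const, ← hI]
    · simp; ring
    all_goals apply Continuous.intervalIntegrable; fun_prop
  have h3 : m * (2 * π) = I := by simp only [m]; field_simp
  have h4 : (∫ φ in (-π)..π, f φ ^ 2) ≥ m * I := by
    have h5 : m ^ 2 * (2 * π) = m * I := by linear_combination m * h3
    linarith
  calc I ^ 2 = (2 * π) * (m * I) := by rw [← h3]; ring
    _ ≤ _ := by gcongr

lemma mode_integrable {f : ℝ → ℝ → ℝ} {g : Pt → ℝ} (hf : Continuous (Function.uncurry f))
    (hg : Integrable g) (hfg : ∀ r φ, f r φ ^ 2 ≤ g (P r φ)) :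
    IntegrableOn (fun r => r * (∫ φ in (-π)..π, f r φ) ^ 2) (Set.Ioi 0) := by
  have h1 := polar_integrable hg
  rw [IntegrableOn, Measure.volume_eq_prod, ← Measure.prod_restrict] at h1
  have hm : Continuous (fun r => r * (∫ φ in (-π)..π, f r φ) ^ 2) := by
    refine continuous_id.mul (Continuous.pow ?_ 2)
    exact intervalIntegral.continuous_parametric_intervalIntegral_of_continuous' hf _ _
  have hpi := pi_pos
  have h2 : IntegrableOn (fun r => (2 * π) * ∫ φ in Set.Ioo (-π) π, r * g (P r φ)) (Set.Ioi 0) :=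
    h1.integral_prod_left.const_mul _
  refine Integrable.mono' h2 hm.aestronglyMeasurable ?_
  have hae := h1.prod_right_ae
  have hpos : ∀ᵐ r : ℝ ∂(volume.restrict (Set.Ioi 0)), 0 < r :=
    (ae_restrict_iff' measurableSet_Ioi).2 (Filter.Eventually.of_forall fun r hr => hr)
  filter_upwards [hae, hpos] with r hr hr0
  have hfr : Continuous (f r) := hf.comp (by fun_prop : Continuous fun φ => (r, φ))
  rw [Real.norm_of_nonneg (by positivity)]
  calc r * (∫ φ in (-π)..π, f r φ) ^ 2 ≤ r * ((2 * π) * ∫ φ in (-π)..π, f r φ ^ 2) := by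
        gcongr; exact cs_aux hfr
    _ = (2 * π) * ∫ φ in Set.Ioo (-π) π, r * f r φ ^ 2 := by
        rw [integral_const_mul, intervalIntegral.integral_of_le (by linarith), integral_Ioc_eq_integral_Ioo]
        ring
    _ ≤ _ := by
        refine mul_le_mul_of_nonneg_left ?_ (by positivity)
        refine integral_mono_ae ?_ hr (Filter.Eventually.of_forall fun φ => ?_)
        · have : IntegrableOn (fun φ => r * f r φ ^ 2) (Set.Icc (-π) π) :=
            (by fun_prop : Continuous fun φ => r * f r φ ^ 2).continuousOn.integrableOn_compact isCompact_Icc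
          exact this.mono_set Set.Ioo_subset_Icc_self
        · have := hfg r φ
          simp only
          gcongr

lemma fourier_aux {f : ℝ → ℝ} (hf : Continuous f) (hper : Function.Periodic f (2 * π))
    (hA : ∀ k : ℕ, k ≠ 1 → ∫ φ in (-π)..π, f φ * cos (k * φ) = 0)
    (hB : ∀ k : ℕ, k ≠ 1 → ∫ φ in (-π)..π, f φ * sin (k * φ) = 0) (x : ℝ) :
    f x = ((∫ φ in (-π)..π, f φ * cos φ) * cos x + (∫ φ in (-π)..π, f φ * sin φ) * sin x) / π := by
  have hpi := pi_pos
  have : Fact (0 < 2 * π) := ⟨by positivity⟩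
  set A := ∫ φ in (-π)..π, f φ * cos φ with hAdef
  set B := ∫ φ in (-π)..π, f φ * sin φ with hBdef
  have hperC : Function.Periodic (fun x => (f x : ℂ)) (2 * π) := fun x => by simp only [hper x]
  let g : C(AddCircle (2 * π), ℂ) := ⟨hperC.lift, by
    have : Continuous (fun x => (f x : ℂ)) := by fun_prop
    exact this.quotient_lift _⟩
  have hg : ∀ y : ℝ, g (y : AddCircle (2 * π)) = (f y : ℂ) := fun y => rfl
  have hco : ∀ n : ℤ, fourierCoeff g n = (1 / (2 * π) : ℂ) *
      (((∫ φ in (-π)..π, f φ * cos (n * φ) : ℝ) : ℂ) - Complex.I * ((∫ φ in (-π)..π, f φ * sin (n * φ) : ℝ) : ℂ)) := by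
    intro n
    rw [fourierCoeff_eq_intervalIntegral g n (-π), show -π + 2 * π = π by ring]
    have h1 : ∀ y : ℝ, fourier (-n) (y : AddCircle (2 * π)) • g y =
        ((f y * cos (n * y) : ℝ) : ℂ) - Complex.I * ((f y * sin (n * y) : ℝ) : ℂ) := by
      intro y
      rw [hg, fourier_coe_apply]
      have : (2 * π * Complex.I * ((-n : ℤ) : ℂ) * y / ((2 * π : ℝ) : ℂ)) = ((-(n * y) : ℝ) : ℂ) * Complex.I := by
        have : (π : ℂ) ≠ 0 := by exact_mod_cast hpi.ne'
        push_cast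
        field_simp
      rw [this, Complex.exp_mul_I, ← Complex.ofReal_cos, ← Complex.ofReal_sin, cos_neg, sin_neg]
      simp only [smul_eq_mul]
      push_cast
      ring
    simp_rw [h1]
    rw [intervalIntegral.integral_sub, intervalIntegral.integral_const_mul, intervalIntegral.integral_ofReal,
      intervalIntegral.integral_ofReal]
    · simp
    all_goals apply Continuous.intervalIntegrable; fun_prop
  have h0 : ∀ n : ℤ, n ∉ ({1, -1} : Finset ℤ) → fourierCoeff g n = 0 := by
    intro n hn
    simp only [Finset.mem_insert, Finset.mem_singleton, not_or] at hn
    rw [hco]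
    obtain ⟨m, rfl | rfl⟩ := n.eq_nat_or_neg
    · have hm : m ≠ 1 := by rintro rfl; simp at hn
      have a := hA m hm
      have b := hB m hm
      simp [a, b]
    · have hm : m ≠ 1 := by rintro rfl; simp at hn
      have a := hA m hm
      have b := hB m hm
      simp [a, b]
  have hs := has_pointwise_sum_fourier_series_of_summable (f := g)
    (summable_of_ne_finset_zero h0) (x : AddCircle (2 * π))
  have hs2 := hasSum_sum_of_ne_finset_zero (f := fun i => fourierCoeff g i • fourier i (x : AddCircle (2 * π)))
    (s := {1, -1}) (L := SummationFilter.unconditional ℤ) (fun n hn => by simp [h0 n hn])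
  have e := hs.unique hs2
  rw [hg, Finset.sum_pair (by norm_num), hco, hco] at e
  have hex : ∀ n : ℤ, fourier n (x : AddCircle (2 * π)) = (cos (n * x) : ℂ) + (sin (n * x)) * Complex.I := by
    intro n
    rw [fourier_coe_apply]
    have : (2 * π * Complex.I * (n : ℂ) * x / ((2 * π : ℝ) : ℂ)) = ((n * x : ℝ) : ℂ) * Complex.I := by
      have : (π : ℂ) ≠ 0 := by exact_mod_cast hpi.ne'
      push_cast
      field_simp
    rw [this, Complex.exp_mul_I, ← Complex.ofReal_cos, ← Complex.ofReal_sin]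
  rw [hex, hex] at e
  simp only [Int.cast_one, one_mul, Int.cast_neg, neg_mul, cos_neg, sin_neg, mul_neg,
    intervalIntegral.integral_neg, ← hAdef, ← hBdef, smul_eq_mul] at e
  have hpc : (π : ℂ) ≠ 0 := by exact_mod_cast hpi.ne'
  have e2 : (f x : ℂ) = (((A * cos x + B * sin x) / π : ℝ) : ℂ) := by
    rw [e]
    push_cast
    field_simp
    ring_nf
    simp only [Complex.I_sq]
    ring
  exact_mod_cast e2

@[fun_prop]
lemma P_continuous {X : Type*} [TopologicalSpace X] {f g : X → ℝ} (hf : Continuous f) (hg : Continuous g) :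
    Continuous (fun x => P (f x) (g x)) := by
  unfold P; fun_prop

lemma pd_zero_phi {Q : Pt → ℝ} (hQs : ContDiff ℝ (⊤ : ℕ∞) Q)
    (hQrad : ∀ x y : Pt, ‖x‖ = ‖y‖ → Q x = Q y) (r φ : ℝ) :
    r * (- sin φ * pd 0 Q (P r φ) + cos φ * pd 1 Q (P r φ)) = 0 := by
  have hd : Differentiable ℝ Q := hQs.differentiable (by simp)
  refine (deriv_phi hd r φ).unique ?_
  have : (fun φ => Q (P r φ)) = fun _ => Q (P r 0) := funext fun φ => hQrad _ _ (by simp [norm_P])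
  rw [this]
  exact hasDerivAt_const _ _

lemma pd_radial {Q : Pt → ℝ} (hQs : ContDiff ℝ (⊤ : ℕ∞) Q)
    (hQrad : ∀ x y : Pt, ‖x‖ = ‖y‖ → Q x = Q y) (r φ : ℝ) :
    cos φ * pd 0 Q (P r φ) + sin φ * pd 1 Q (P r φ) = pd 0 Q (P r 0) := by
  have hd : Differentiable ℝ Q := hQs.differentiable (by simp)
  have h1 := deriv_r hd r φ
  have h2 := deriv_r hd r 0
  have : (fun r => Q (P r φ)) = fun r => Q (P r 0) := funext fun r => hQrad _ _ (by simp [norm_P])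
  rw [this] at h1
  have := h1.unique h2
  simpa using this

lemma gs_of {Q : Pt → ℝ} (hQs : ContDiff ℝ (⊤ : ℕ∞) Q) (hQpos : ∀ x, 0 < Q x)
    (hQrad : ∀ x y : Pt, ‖x‖ = ‖y‖ → Q x = Q y)
    (hQeq : ∀ x, -(lap Q x) + Q x = Q x ^ 3)
    (hQ2 : Integrable (fun x : Pt => Q x ^ 2)) :
    GS (fun r => Q (P r 0)) (fun r => pd 0 Q (P r 0)) (fun r => pd 0 (pd 0 Q) (P r 0))
      (fun r => pd 0 (pd 0 (pd 0 Q)) (P r 0)) := by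
  have c1 : ∀ j, ContDiff ℝ (⊤ : ℕ∞) (pd j Q) := fun j => pd_contDiff hQs (by simp) j
  have c2 : ∀ i j, ContDiff ℝ (⊤ : ℕ∞) (pd i (pd j Q)) := fun i j => pd_contDiff (c1 j) (by simp) i
  have dr : ∀ f : Pt → ℝ, ContDiff ℝ (⊤ : ℕ∞) f → ∀ r, HasDerivAt (fun r => f (P r 0)) (pd 0 f (P r 0)) r := by
    intro f hf r
    simpa using deriv_r (hf.differentiable (by simp)) r 0
  refine ⟨dr _ hQs, dr _ (c1 0), dr _ (c2 0 0), ?_, fun r => hQpos _, ?_⟩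
  · intro r
    rcases eq_or_ne r 0 with rfl | hr
    · have h1 := dr _ hQs 0
      have h2 : HasDerivAt (fun r => Q (P r 0)) (- pd 0 Q (P 0 0)) 0 := by
        have h3 := (dr _ hQs (-0)).comp (0:ℝ) (hasDerivAt_neg (0:ℝ))
        have : (fun r => Q (P r 0)) ∘ Neg.neg = fun r => Q (P r 0) :=
          funext fun r => hQrad _ _ (by simp [norm_P])
        rw [this] at h3
        simpa using h3
      have := h1.unique h2
      simp only [zero_mul, zero_add]
      linarith
    · have hz : ∀ φ, r * (- sin φ * pd 0 Q (P r φ) + cos φ * pd 1 Q (P r φ)) = 0 :=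
        pd_zero_phi hQs hQrad r
      have hd0 := deriv_phi ((c1 0).differentiable (by simp)) r 0
      have hd1 := deriv_phi ((c1 1).differentiable (by simp)) r 0
      have hd := ((((hasDerivAt_sin 0).neg).mul hd0).add ((hasDerivAt_cos 0).mul hd1)).const_mul r
      have hc : HasDerivAt (fun φ => r * (- sin φ * pd 0 Q (P r φ) + cos φ * pd 1 Q (P r φ))) 0 0 := by
        rw [show (fun φ => r * (- sin φ * pd 0 Q (P r φ) + cos φ * pd 1 Q (P r φ))) = fun _ => 0 from funext hz]
        exact hasDerivAt_const _ _
      have e := HasDerivAt.unique hd hc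
      simp at e
      have e2 := hQeq (P r 0)
      rw [lap_eq] at e2
      rcases e with e | e
      · exact absurd e hr
      · linear_combination -e - r * e2
  · intro ε hε R
    by_contra! hh
    have hcQ : Continuous Q := hQs.continuous
    have hi := mode_integrable (f := fun r φ => Q (P r φ)) (g := fun x => Q x ^ 2)
      (hcQ.comp P_cont) hQ2 (fun r φ => le_rfl)
    have hpi := pi_pos
    refine no_inf (R := max R 1) (c := (2 * π * ε) ^ 2) (by positivity)
      (hi.mono_set (Set.Ioi_subset_Ioi (by simp))) fun r hr => ?_
    have hr1 : R < r := (le_max_left _ _).trans_lt hr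
    have hr2 : 1 < r := (le_max_right _ _).trans_lt hr
    have : (fun φ => Q (P r φ)) = fun _ => Q (P r 0) := funext fun φ => hQrad _ _ (by simp [norm_P])
    simp only [this, intervalIntegral.integral_const, smul_eq_mul]
    have h3 := hh r hr1
    have h4 : (2 * π * ε) ^ 2 ≤ ((π - -π) * Q (P r 0)) ^ 2 := by
      rw [show π - -π = 2 * π by ring]; gcongr
    nlinarith [sq_nonneg (2 * π * ε)]

lemma rad_of {Q : Pt → ℝ} (hQrad : ∀ x y : Pt, ‖x‖ = ‖y‖ → Q x = Q y)
    {v : Pt → ℝ} (hv : ContDiff ℝ 2 v)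
    (hv2 : Integrable (fun x : Pt => v x ^ 2))
    (hvg : Integrable (fun x : Pt => ‖gradient v x‖ ^ 2))
    (heq : ∀ x : Pt, -(lap v x) + v x - 3 * Q x ^ 2 * v x = 0) (k : ℕ) (α : ℝ) :
    Rad k (fun r => Q (P r 0)) (fun r => ∫ φ in (-π)..π, v (P r φ) * cos (k * φ + α))
      (fun r => ∫ φ in (-π)..π, (cos φ * pd 0 v (P r φ) + sin φ * pd 1 v (P r φ)) * cos (k * φ + α))
      (fun r => ∫ φ in (-π)..π, (cos φ * (cos φ * pd 0 (pd 0 v) (P r φ) + sin φ * pd 1 (pd 0 v) (P r φ))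
        + sin φ * (cos φ * pd 0 (pd 1 v) (P r φ) + sin φ * pd 1 (pd 1 v) (P r φ))) * cos (k * φ + α)) := by
  have c1 : ∀ j, ContDiff ℝ 1 (pd j v) := fun j => pd_contDiff hv (by norm_num) j
  have c2 : ∀ i j, Continuous (pd i (pd j v)) := fun i j =>
    (pd_contDiff (n := 0) (c1 j) (by norm_num) i).continuous
  have dv : Differentiable ℝ v := hv.differentiable (by norm_num)
  have d1 : ∀ j, Differentiable ℝ (pd j v) := fun j => (c1 j).differentiable (by norm_num)
  have k0 : Continuous v := hv.continuous
  have k10 : Continuous (pd 0 v) := (c1 0).continuous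
  have k11 : Continuous (pd 1 v) := (c1 1).continuous
  have k200 := c2 0 0
  have k201 := c2 0 1
  have k210 := c2 1 0
  have k211 := c2 1 1
  have C0 : Continuous (Function.uncurry fun r φ => v (P r φ) * cos (k * φ + α)) := by
    simp only [Function.uncurry_def]; fun_prop
  have C1 : Continuous (Function.uncurry fun r φ =>
      (cos φ * pd 0 v (P r φ) + sin φ * pd 1 v (P r φ)) * cos (k * φ + α)) := by
    simp only [Function.uncurry_def]; fun_prop
  have C2 : Continuous (Function.uncurry fun r φ =>
      (cos φ * (cos φ * pd 0 (pd 0 v) (P r φ) + sin φ * pd 1 (pd 0 v) (P r φ))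
        + sin φ * (cos φ * pd 0 (pd 1 v) (P r φ) + sin φ * pd 1 (pd 1 v) (P r φ))) * cos (k * φ + α)) := by
    simp only [Function.uncurry_def]; fun_prop
  have sl : ∀ (f : ℝ → ℝ → ℝ), Continuous (Function.uncurry f) → ∀ r, Continuous (f r) :=
    fun f hf r => hf.comp (by fun_prop : Continuous fun φ => (r, φ))
  refine ⟨?_, ?_, ?_, ?_, ?_⟩
  · intro r
    exact hasDerivAt_param (sl _ C0) C1 (fun r φ => (deriv_r dv r φ).mul_const _) _ _ r
  · intro r
    refine hasDerivAt_param (sl _ C1) C2 (fun r φ => HasDerivAt.mul_const ?_ _) _ _ r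
    exact ((deriv_r (d1 0) r φ).const_mul _).add ((deriv_r (d1 1) r φ).const_mul _)
  · exact intervalIntegral.continuous_parametric_intervalIntegral_of_continuous' C2 _ _
  · intro r
    -- integration by parts on the circle
    set Fp : ℝ → ℝ := fun φ => r * (- sin φ * pd 0 v (P r φ) + cos φ * pd 1 v (P r φ)) with hFp
    set Fpp : ℝ → ℝ := fun φ => r * ((- cos φ * pd 0 v (P r φ) + - sin φ *
        (r * (- sin φ * pd 0 (pd 0 v) (P r φ) + cos φ * pd 1 (pd 0 v) (P r φ)))) +
        (- sin φ * pd 1 v (P r φ) + cos φ *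
        (r * (- sin φ * pd 0 (pd 1 v) (P r φ) + cos φ * pd 1 (pd 1 v) (P r φ))))) with hFpp
    have hd1 : ∀ φ, HasDerivAt Fp (Fpp φ) φ := fun φ =>
      ((((hasDerivAt_sin φ).neg).mul (deriv_phi (d1 0) r φ)).add
        ((hasDerivAt_cos φ).mul (deriv_phi (d1 1) r φ))).const_mul r
    have hlin : ∀ φ : ℝ, HasDerivAt (fun φ : ℝ => (k:ℝ) * φ + α) k φ := fun φ => by
      simpa using ((hasDerivAt_id φ).const_mul (k:ℝ)).add_const α
    have hd2 : ∀ φ, HasDerivAt (fun φ => Fp φ * cos (k * φ + α) + v (P r φ) * (k * sin (k * φ + α)))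
        (Fpp φ * cos (k * φ + α) + k ^ 2 * (v (P r φ) * cos (k * φ + α))) φ := by
      intro φ
      refine (((hd1 φ).mul (hlin φ).cos).add
        ((deriv_phi dv r φ).mul ((hlin φ).sin.const_mul (k:ℝ)))).congr_deriv ?_
      simp only [hFp]
      ring
    have hzero : ∫ φ in (-π)..π, (Fpp φ * cos (k * φ + α) + k ^ 2 * (v (P r φ) * cos (k * φ + α))) = 0 := by
      rw [intervalIntegral.integral_eq_sub_of_hasDerivAt (fun φ _ => hd2 φ)]
      · have hc : cos (k * -π + α) = cos (k * π + α) := by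
          rw [← cos_add_nat_mul_two_pi (k * -π + α) k]; congr 1; ring
        have hs : sin (k * -π + α) = sin (k * π + α) := by
          rw [← sin_add_nat_mul_two_pi (k * -π + α) k]; congr 1; ring
        have hP : P r (-π) = P r π := by simp [P]
        simp only [hFp, hc, hs, hP]
        simp
      · apply Continuous.intervalIntegrable
        simp only [hFpp]
        fun_prop
    -- express everything as one integral
    have hQr : ∀ φ, Q (P r φ) = Q (P r 0) := fun φ => hQrad _ _ (by simp [norm_P])
    refine Eq.trans (b := -(∫ φ in (-π)..π, (Fpp φ * cos (k * φ + α)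
      + k ^ 2 * (v (P r φ) * cos (k * φ + α))))) ?_ (by rw [hzero, neg_zero])
    generalize Q (P r 0) = q at hQr ⊢
    rw [← intervalIntegral.integral_neg]
    simp only [← intervalIntegral.integral_const_mul]
    simp only [sub_eq_add_neg, ← intervalIntegral.integral_neg]
    rw [← intervalIntegral.integral_add, ← intervalIntegral.integral_add, ← intervalIntegral.integral_add]
    · refine intervalIntegral.integral_congr fun φ _ => ?_
      have h := heq (P r φ)
      rw [lap_eq, hQr φ] at h
      simp only [hFpp]
      linear_combination cos (k * φ + α) * r ^ 2 * (pd 0 (pd 0 v) (P r φ) + pd 1 (pd 1 v) (P r φ)) *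
        (sin_sq_add_cos_sq φ) - cos (k * φ + α) * r ^ 2 * h
    all_goals apply Continuous.intervalIntegrable; fun_prop
  · have hi0 := mode_integrable (f := fun r φ => v (P r φ) * cos (k * φ + α)) C0 hv2 (fun r φ => by
      rw [mul_pow]
      have := cos_sq_le_one (k * φ + α)
      nlinarith [sq_nonneg (v (P r φ))])
    have hi1 := mode_integrable (f := fun r φ =>
      (cos φ * pd 0 v (P r φ) + sin φ * pd 1 v (P r φ)) * cos (k * φ + α)) C1 hvg (fun r φ => by
      rw [mul_pow]
      have h1 := cos_sq_le_one (k * φ + α)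
      have h2 : cos φ * pd 0 v (P r φ) + sin φ * pd 1 v (P r φ) = fderiv ℝ v (P r φ) (P 1 φ) := by
        have hP1 : P 1 φ = cos φ • EuclideanSpace.single (0 : Fin 2) (1:ℝ)
            + sin φ • EuclideanSpace.single (1 : Fin 2) (1:ℝ) := by simp [P]
        rw [hP1]
        simp [pd, map_add, map_smul]
      have h3 : ‖gradient v (P r φ)‖ = ‖fderiv ℝ v (P r φ)‖ := by
        simp [gradient]
      have h4 : |fderiv ℝ v (P r φ) (P 1 φ)| ≤ ‖fderiv ℝ v (P r φ)‖ := by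
        have := (fderiv ℝ v (P r φ)).le_opNorm (P 1 φ)
        rw [norm_P] at this
        simpa using this
      rw [h2, h3]
      have h5 : (fderiv ℝ v (P r φ) (P 1 φ)) ^ 2 ≤ ‖fderiv ℝ v (P r φ)‖ ^ 2 := by
        rw [← sq_abs]; gcongr
      nlinarith [sq_nonneg (fderiv ℝ v (P r φ) (P 1 φ))])
    refine (hi0.add hi1).congr_fun (fun r _ => ?_) measurableSet_Ioi
    simp only [Pi.add_apply]
    ring

lemma forward_aux {Q : Pt → ℝ} (hQs : ContDiff ℝ (⊤ : ℕ∞) Q) (hQpos : ∀ x, 0 < Q x)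
    (hQrad : ∀ x y : Pt, ‖x‖ = ‖y‖ → Q x = Q y)
    (hQeq : ∀ x, -(lap Q x) + Q x = Q x ^ 3)
    (hQ2 : Integrable (fun x : Pt => Q x ^ 2))
    {v : Pt → ℝ} (hv : ContDiff ℝ 2 v)
    (hv2 : Integrable (fun x : Pt => v x ^ 2))
    (hvg : Integrable (fun x : Pt => ‖gradient v x‖ ^ 2))
    (heq : ∀ x : Pt, -(lap v x) + v x - 3 * Q x ^ 2 * v x = 0) :
    ∃ c₁ c₂ : ℝ, ∀ x : Pt, v x = c₁ * pd 0 Q x + c₂ * pd 1 Q x := by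
  have g := gs_of hQs hQpos hQrad hQeq hQ2
  have R := rad_of hQrad hv hv2 hvg heq
  have hs : ∀ x : ℝ, cos (x + -(π / 2)) = sin x := fun x => by
    rw [← sub_eq_add_neg, cos_sub_pi_div_two]
  -- all modes but the first vanish
  have hmode : ∀ k : ℕ, k ≠ 1 → ∀ α r, 0 ≤ r → ∫ φ in (-π)..π, v (P r φ) * cos (k * φ + α) = 0 := by
    intro k hk α r hr
    rcases Nat.eq_zero_or_pos k with h0 | h0
    · subst h0
      have h := R 0 α
      rw [show (((0:ℕ):ℝ)) = 0 by simp] at h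
      simpa using h.radial_zero g r hr
    · have h2 : 1 < k := by omega
      exact (R k α).high_zero g (by exact_mod_cast h2) r hr
  have hone : ∀ α, ∃ c, ∀ r, 0 ≤ r → ∫ φ in (-π)..π, v (P r φ) * cos (φ + α) = c * pd 0 Q (P r 0) := by
    intro α
    have h := R 1 α
    rw [show (((1:ℕ):ℝ)) = 1 by simp] at h
    simpa using h.one_mult g
  obtain ⟨c, hc⟩ := hone 0
  obtain ⟨d, hd⟩ := hone (-(π / 2))
  simp only [add_zero] at hc
  simp only [hs] at hd
  have hcv : Continuous v := hv.continuous
  have hpi := pi_pos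
  refine ⟨c / π, d / π, fun x => ?_⟩
  obtain ⟨r, φ, hr, rfl⟩ := exists_P x
  have hF := fourier_aux (f := fun φ => v (P r φ)) (by fun_prop) (fun φ => by simp [P])
    (fun k hk => by simpa using hmode k hk 0 r hr)
    (fun k hk => by simpa only [hs] using hmode k hk (-(π / 2)) r hr) φ
  rw [hc r hr, hd r hr] at hF
  have h0 : pd 0 Q (P r φ) = cos φ * pd 0 Q (P r 0) ∧ pd 1 Q (P r φ) = sin φ * pd 0 Q (P r 0) := by
    rcases hr.eq_or_lt with h | h
    · subst h
      have hP : ∀ φ, P 0 φ = P 0 0 := fun φ => by simp [P]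
      have hz : pd 0 Q (P 0 0) = 0 := g.q1_zero
      have h1 := pd_radial hQs hQrad 0 (π / 2)
      simp only [hP (π / 2), hz, cos_pi_div_two, sin_pi_div_two] at h1
      rw [hP φ, hz]
      constructor
      · simp
      · linarith
    · have h1 := pd_radial hQs hQrad r φ
      have h2 := (mul_eq_zero.1 (pd_zero_phi hQs hQrad r φ)).resolve_left h.ne'
      have h3 := sin_sq_add_cos_sq φ
      constructor
      · linear_combination cos φ * h1 - sin φ * h2 - pd 0 Q (P r φ) * h3
      · linear_combination sin φ * h1 + cos φ * h2 - pd 1 Q (P r φ) * h3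
  rw [h0.1, h0.2]
  rw [hF]
  ring

lemma pd_comb {f g : Pt → ℝ} (hf : Differentiable ℝ f) (hg : Differentiable ℝ g) (a b : ℝ) (j : Fin 2) :
    pd j (fun x => a * f x + b * g x) = fun x => a * pd j f x + b * pd j g x := by
  funext x
  have h := (((hf x).hasFDerivAt.const_mul a).add ((hg x).hasFDerivAt.const_mul b)).fderiv
  simp only [pd]
  change fderiv ℝ ((fun x => a * f x) + fun x => b * g x) x _ = _
  rw [h]
  simp

lemma lap_pd {Q : Pt → ℝ} (hQs : ContDiff ℝ (⊤ : ℕ∞) Q)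
    (hQeq : ∀ x, -(lap Q x) + Q x = Q x ^ 3) (j : Fin 2) (x : Pt) :
    lap (pd j Q) x = pd j Q x - 3 * Q x ^ 2 * pd j Q x := by
  have c1 : ∀ j, ContDiff ℝ (⊤ : ℕ∞) (pd j Q) := fun j => pd_contDiff hQs (by simp) j
  have c2 : ∀ i j, ContDiff ℝ (⊤ : ℕ∞) (pd i (pd j Q)) := fun i j => pd_contDiff (c1 j) (by simp) i
  have t : ∀ f : Pt → ℝ, ContDiff ℝ (⊤ : ℕ∞) f → ContDiff ℝ 2 f := fun f hf => contDiff_infty.1 hf 2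
  have hsw : ∀ i, pd i (pd i (pd j Q)) x = pd j (pd i (pd i Q)) x := by
    intro i
    have : pd i (pd j Q) = pd j (pd i Q) := funext fun y => pd_comm (t _ hQs) i j y
    rw [this, pd_comm (t _ (c1 i))]
  have hL : (fun x => 1 * pd 0 (pd 0 Q) x + 1 * pd 1 (pd 1 Q) x) = fun x => Q x - Q x ^ 3 := by
    funext y
    have := hQeq y
    rw [lap_eq] at this
    linarith
  have h1 := congrFun (pd_comb ((c2 0 0).differentiable (by simp)) ((c2 1 1).differentiable (by simp)) 1 1 j) x
  rw [hL] at h1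
  have hQd := ((hQs.differentiable (by simp)) x).hasFDerivAt
  have h2 : pd j (fun x => Q x - Q x ^ 3) x = pd j Q x - 3 * Q x ^ 2 * pd j Q x := by
    have h := (hQd.sub (hQd.pow 3)).fderiv
    simp only [pd]
    change fderiv ℝ (Q - fun x => Q x ^ 3) x _ = _
    rw [h]
    simp
  rw [lap_eq, hsw, hsw, ← h2, h1]
  ring

/-- Nondegeneracy of the ground state: with `Q` the positive radial ground state of
`-ΔQ + Q = Q³` in `ℝ²` and `𝓛̃ = -Δ + 1 - 3Q²`, the kernel of `𝓛̃` on `H²(ℝ²)` is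
spanned by `∂Q/∂x₁` and `∂Q/∂x₂`. -/
theorem kernel_linearized_operator (Q : Pt → ℝ)
    (hQs : ContDiff ℝ (⊤ : ℕ∞) Q)
    (hQpos : ∀ x, 0 < Q x)
    (hQrad : ∀ x y : Pt, ‖x‖ = ‖y‖ → Q x = Q y)
    (hQeq : ∀ x, -(lap Q x) + Q x = Q x ^ 3)
    (hQ2 : Integrable (fun x : Pt => Q x ^ 2))
    (v : Pt → ℝ)
    (hv : ContDiff ℝ 2 v)
    (hv2 : Integrable (fun x : Pt => v x ^ 2))
    (hvg : Integrable (fun x : Pt => ‖gradient v x‖ ^ 2))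
    (hvlap : Integrable (fun x : Pt => (lap v x) ^ 2)) :
    (∀ x : Pt, -(lap v x) + v x - 3 * Q x ^ 2 * v x = 0) ↔
      ∃ c₁ c₂ : ℝ, ∀ x : Pt,
        v x = c₁ * fderiv ℝ Q x (EuclideanSpace.single 0 1)
            + c₂ * fderiv ℝ Q x (EuclideanSpace.single 1 1) := by
  constructor
  · intro heq
    exact forward_aux hQs hQpos hQrad hQeq hQ2 hv hv2 hvg heq
  · rintro ⟨a, b, h⟩ x
    have hv' : v = fun x => a * pd 0 Q x + b * pd 1 Q x := funext h
    have c1 : ∀ j, ContDiff ℝ (⊤ : ℕ∞) (pd j Q) := fun j => pd_contDiff hQs (by simp) j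
    have d1 : ∀ j, Differentiable ℝ (pd j Q) := fun j => (c1 j).differentiable (by simp)
    have d2 : ∀ i j, Differentiable ℝ (pd i (pd j Q)) := fun i j =>
      (pd_contDiff (n := (⊤ : ℕ∞)) (c1 j) (by simp) i).differentiable (by simp)
    have hl : lap v x = a * lap (pd 0 Q) x + b * lap (pd 1 Q) x := by
      simp only [lap_eq]
      rw [hv', pd_comb (d1 0) (d1 1), pd_comb (d1 0) (d1 1), pd_comb (d2 _ _) (d2 _ _), pd_comb (d2 _ _) (d2 _ _)]
      ring
    rw [hl, lap_pd hQs hQeq, lap_pd hQs hQeq, hv']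
    ring
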